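/- Let A = (Q, δ, I, F) be a complete BA and P a partition block of A such that every SCC of A contained in P is accepting and deterministic and every accepting transition of A has both endpoints in a single SCC contained in P. Let D be the TELA with states 2^Q × 2^P × 2^P × 2^P, single colour 0, acceptance Inf 0, initial state (I, I ∩ P, ∅, I ∩ P), and transitions as follows: from (H, C, S, B) over a ∈ Σ there is no transition if δ_F(S,a) ≠ ∅; otherwise, setting S' = δ_SCC(S,a) ∩ P, C' = (δ(H,a) ∩ P) \ S', B* = δ_SCC(B,a), and B' = C' if B* = ∅ and B' = B* otherwise, there is a transition to (δ(H,a), C', S', B') with colour set {0} if B* = ∅ and colour set ∅ otherwise, and, in case δ_F(B,a) ∩ δ_SCC(B,a) = ∅, additionally a transition to (δ(H,a), C'', S'', C'') with colour set {0}, where S'' = S' ∪ B' and C'' = C' \ S''. Then L(D) = Σ^ω \ L(A). -/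

import Mathlib

attribute [local instance] Classical.propDecidable

universe u v w y

/-- Emerson–Lei acceptance conditions over colours `γ`. -/
inductive EL (γ : Type u) : Type u
  | inf : γ → EL γ
  | fin : γ → EL γ
  | conj : EL γ → EL γ → EL γ
  | disj : EL γ → EL γ → EL γ

/-- Satisfaction of an Emerson–Lei condition by a set `M` of colours. -/
def EL.sat {γ : Type u} (M : Set γ) : EL γ → Prop
  | .inf c => c ∈ M
  | .fin c => c ∉ M
  | .conj φ ψ => φ.sat M ∧ ψ.sat M
  | .disj φ ψ => φ.sat M ∨ ψ.sat M

/-- Renaming of colours in an Emerson–Lei condition. -/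
def EL.map {γ : Type u} {γ' : Type v} (f : γ → γ') : EL γ → EL γ'
  | .inf c => .inf (f c)
  | .fin c => .fin (f c)
  | .conj φ ψ => .conj (φ.map f) (ψ.map f)
  | .disj φ ψ => .disj (φ.map f) (ψ.map f)

/-- A (transition-based) Büchi automaton over alphabet `A` with states `Q`. -/
structure BA (Q : Type u) (A : Type v) where
  delta : Set (Q × A × Q)
  init : Set Q
  F : Set (Q × A × Q)
  F_sub : F ⊆ delta

namespace BA

variable {Q : Type u} {A : Type v}

/-- `δ(S, a)`. -/
def deltaSet (M : BA Q A) (S : Set Q) (a : A) : Set Q :=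
  {q | ∃ p ∈ S, (p, a, q) ∈ M.delta}

/-- `δ_F(S, a)`. -/
def deltaF (M : BA Q A) (S : Set Q) (a : A) : Set Q :=
  {q | ∃ p ∈ S, (p, a, q) ∈ M.F}

/-- `δ(S, u)` for a finite word `u`. -/
def deltaWord (M : BA Q A) (S : Set Q) : List A → Set Q
  | [] => S
  | a :: u => M.deltaWord (M.deltaSet S a) u

/-- A run of the BA on an infinite word. -/
def IsRun (M : BA Q A) (w : ℕ → A) (ρ : ℕ → Q) : Prop :=
  ρ 0 ∈ M.init ∧ ∀ i, (ρ i, w i, ρ (i + 1)) ∈ M.delta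

/-- An accepting run of the BA on an infinite word. -/
def AccRun (M : BA Q A) (w : ℕ → A) (ρ : ℕ → Q) : Prop :=
  M.IsRun w ρ ∧ {i | (ρ i, w i, ρ (i + 1)) ∈ M.F}.Infinite

/-- The language of the BA. -/
def lang (M : BA Q A) : Set (ℕ → A) := {w | ∃ ρ, M.AccRun w ρ}

/-- Completeness of a BA. -/
def Complete (M : BA Q A) : Prop :=
  M.init.Nonempty ∧ ∀ q a, ∃ q', (q, a, q') ∈ M.delta

/-- One transition step (over some symbol). -/
def Step (M : BA Q A) (p q : Q) : Prop := ∃ a, (p, a, q) ∈ M.delta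

/-- Reachability. -/
def Reach (M : BA Q A) : Q → Q → Prop := Relation.ReflTransGen M.Step

/-- Mutual reachability, i.e., lying in the same SCC. -/
def SameSCC (M : BA Q A) (p q : Q) : Prop := M.Reach p q ∧ M.Reach q p

/-- A strongly connected component: a maximal nonempty set of pairwise
mutually reachable states. -/
def IsSCC (M : BA Q A) (C : Set Q) : Prop :=
  C.Nonempty ∧ (∀ p ∈ C, ∀ q ∈ C, M.Reach p q) ∧
    ∀ D, C ⊆ D → (∀ p ∈ D, ∀ q ∈ D, M.Reach p q) → D ⊆ C

/-- An accepting SCC: one containing an accepting transition with both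
endpoints in it. -/
def IsAccSCC (M : BA Q A) (C : Set Q) : Prop :=
  M.IsSCC C ∧ ∃ p ∈ C, ∃ a, ∃ q ∈ C, (p, a, q) ∈ M.F

/-- `δ_SCC(S, a)`: restriction of `δ` to transitions staying in one SCC. -/
def deltaSCC (M : BA Q A) (S : Set Q) (a : A) : Set Q :=
  {q | ∃ p ∈ S, (p, a, q) ∈ M.delta ∧ M.SameSCC p q}

/-- A cycle of length `k > 0` lying inside the set `C`. -/
def IsCycleIn (M : BA Q A) (C : Set Q) (k : ℕ) (ρ : ℕ → Q) (σ : ℕ → A) : Prop :=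
  0 < k ∧ ρ 0 = ρ k ∧ ∀ i < k, ρ i ∈ C ∧ (ρ i, σ i, ρ (i + 1)) ∈ M.delta

/-- `C` is inherently weak: every cycle inside `C` contains an accepting
transition, or no cycle inside `C` contains one. -/
def InherentlyWeak (M : BA Q A) (C : Set Q) : Prop :=
  (∀ k ρ σ, M.IsCycleIn C k ρ σ → ∃ i < k, (ρ i, σ i, ρ (i + 1)) ∈ M.F) ∨
  (∀ k ρ σ, M.IsCycleIn C k ρ σ → ∀ i < k, (ρ i, σ i, ρ (i + 1)) ∉ M.F)

/-- `C` is a deterministic SCC. -/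
def DetSCC (M : BA Q A) (C : Set Q) : Prop :=
  ∀ q ∈ C, ∀ a : A, (M.deltaSet {q} a ∩ C).Subsingleton

/-- A partition block: a nonempty union of accepting SCCs. -/
def IsPartitionBlock (M : BA Q A) (P : Set Q) : Prop :=
  P.Nonempty ∧ ∃ Cs : Set (Set Q), (∀ C ∈ Cs, M.IsAccSCC C) ∧ P = ⋃₀ Cs

/-- `A_P`: accepting transitions restricted to those between states of `P`. -/
def restrict (M : BA Q A) (P : Set Q) : BA Q A where
  delta := M.delta
  init := M.init
  F := M.F ∩ {t | t.1 ∈ P ∧ t.2.2 ∈ P}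
  F_sub := fun _ ht => M.F_sub ht.1

end BA

/-- A partitioning of a BA: pairwise disjoint partition blocks containing
all accepting SCCs. -/
def IsPartitioning {Q : Type u} {A : Type v} {n : ℕ} (M : BA Q A)
    (P : Fin n → Set Q) : Prop :=
  (∀ i, M.IsPartitionBlock (P i)) ∧
  (Pairwise fun i j => Disjoint (P i) (P j)) ∧
  ∀ C, M.IsAccSCC C → ∃ i, C ⊆ P i

/-- A transition-based Emerson–Lei automaton; transitions carry sets of
colours. -/
structure TELA (Q : Type u) (A : Type v) (γ : Type w) where
  trans : Set (Q × A × Set γ × Q)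
  init : Set Q
  acc : EL γ

namespace TELA

variable {Q : Type u} {A : Type v} {γ : Type w}

/-- A run of the TELA (state sequence together with emitted colour sets). -/
def IsRun (T : TELA Q A γ) (w : ℕ → A) (ρ : ℕ → Q) (κ : ℕ → Set γ) : Prop :=
  ρ 0 ∈ T.init ∧ ∀ i, (ρ i, w i, κ i, ρ (i + 1)) ∈ T.trans

/-- The union of colour sets of transitions occurring infinitely often. -/
def infCols (w : ℕ → A) (ρ : ℕ → Q) (κ : ℕ → Set γ) : Set γ :=
  {c | ∃ t : Q × A × Set γ × Q,
    {i | (ρ i, w i, κ i, ρ (i + 1)) = t}.Infinite ∧ c ∈ t.2.2.1}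

/-- An accepting run of the TELA. -/
def AccRun (T : TELA Q A γ) (w : ℕ → A) (ρ : ℕ → Q) (κ : ℕ → Set γ) : Prop :=
  T.IsRun w ρ κ ∧ EL.sat (infCols w ρ κ) T.acc

/-- The language of the TELA. -/
def lang (T : TELA Q A γ) : Set (ℕ → A) := {w | ∃ ρ κ, T.AccRun w ρ κ}

end TELA

/-- A partial complementation instance for a partition block. -/
structure PartialAlg (Q : Type u) (A : Type v) (T : Type w) (γ : Type y) where
  init : Set T
  succ : Set Q → T → A → Set (T × Set γ)
  acc : EL γ

/-- `ModCompl` for a single partial complementation instance. -/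
def ModCompl1 {Q : Type u} {A : Type v} {T : Type w} {γ : Type y}
    (M : BA Q A) (alg : PartialAlg Q A T γ) : TELA (Set Q × T) A γ where
  init := {x | x.1 = M.init ∧ x.2 ∈ alg.init}
  trans := {x | ∃ H m a m' α, (m', α) ∈ alg.succ H m a ∧
    x = ((H, m), a, α, (M.deltaSet H a, m'))}
  acc := alg.acc

/-- Conjunction of a nonempty family of Emerson–Lei conditions. -/
def ELbigAnd {γ : Type u} {n : ℕ} (f : Fin (n + 1) → EL γ) : EL γ :=
  List.foldl EL.conj (f 0) (List.ofFn fun i : Fin n => f i.succ)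

/-- The synchronous modular complementation `ModCompl` for several partial
complementation instances; colours are renumbered via `Sigma.mk`. -/
def ModComplN {Q : Type u} {A : Type v} {n : ℕ} {T : Fin (n + 1) → Type w}
    {γ : Fin (n + 1) → Type y} (M : BA Q A)
    (alg : ∀ i, PartialAlg Q A (T i) (γ i)) :
    TELA (Set Q × (∀ i, T i)) A (Σ i, γ i) where
  init := {x | x.1 = M.init ∧ ∀ i, x.2 i ∈ (alg i).init}
  trans := {x | ∃ (H : Set Q) (m : ∀ i, T i) (a : A) (m' : ∀ i, T i)
      (α : ∀ i, Set (γ i)),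
    (∀ i, (m' i, α i) ∈ (alg i).succ H (m i) a) ∧
    x = ((H, m), a, {c : Σ i, γ i | c.2 ∈ α c.1}, (M.deltaSet H a, m'))}
  acc := ELbigAnd fun i => ((alg i).acc).map (Sigma.mk i)

/-- A partial round-robin complementation instance. -/
structure RRAlg (Q : Type u) (A : Type v) (Tt Ta : Type w) (γ : Type y) where
  init : Set Tt
  succT : Set Q → Tt → A → Set (Tt × Set γ)
  succA : Set Q → Ta → A → Set ((Tt ⊕ Ta) × Set γ)
  lift : Tt → Set Ta
  acc : EL γ

/-- The flattening `algunion` of a partial round-robin instance. -/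
def RRAlg.flatten {Q : Type u} {A : Type v} {Tt Ta : Type w} {γ : Type y}
    (R : RRAlg Q A Tt Ta γ) : PartialAlg Q A (Tt ⊕ Ta) γ where
  init := Sum.inl '' R.init
  succ := fun H m a =>
    match m with
    | Sum.inr mA => R.succA H mA a
    | Sum.inl mT =>
        {x | ∃ p ∈ R.succT H mT a, x = (Sum.inl p.1, p.2)} ∪
        {x | ∃ p ∈ R.succT H mT a, ∃ m'' ∈ R.lift p.1, x = (Sum.inr m'', p.2)}
  acc := R.acc

/-- Consistency (conditions (C1)–(C3)) of a partial round-robin instance with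
respect to a BA `B`. -/
def RRConsistent {Q : Type u} {A : Type v} {Tt Ta : Type w} {γ : Type y}
    (B : BA Q A) (R : RRAlg Q A Tt Ta γ) : Prop :=
  (∀ w ∈ (ModCompl1 B R.flatten).lang, ∃ ρ κ,
      (ModCompl1 B R.flatten).AccRun w ρ κ ∧
      {j | (ρ j).2.isRight = true ∧ ¬ (ρ (j + 1)).2.isRight = true}.Infinite) ∧
  (∀ w ρ κ, (ModCompl1 B R.flatten).AccRun w ρ κ → ∀ i : ℕ,
      (i = 0 ∨ (ρ (i - 1)).2.isLeft = true) →
      ((∃ ρ' κ', (ModCompl1 B R.flatten).AccRun w ρ' κ' ∧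
          (∀ j < i, ρ' j = ρ j) ∧ (ρ' i).2.isLeft = true) ∧
       (∃ ρ'' κ'', (ModCompl1 B R.flatten).AccRun w ρ'' κ'' ∧
          (∀ j < i, ρ'' j = ρ j) ∧ (ρ'' i).2.isRight = true))) ∧
  (∀ w ρ κ, (ModCompl1 B R.flatten).IsRun w ρ κ →
      {j | (ρ j).2.isRight = true ∧ ¬ (ρ (j + 1)).2.isRight = true}.Infinite →
      (ModCompl1 B R.flatten).AccRun w ρ κ)

/-- The NCSB-style complementation TELA for a partition block `P` consisting
of deterministic accepting SCCs. -/
def dacTELA {Q A : Type} (M : BA Q A) (P : Set Q) :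
    TELA (Set Q × Set Q × Set Q × Set Q) A Unit where
  init := {(M.init, M.init ∩ P, ∅, M.init ∩ P)}
  trans := {x | ∃ (H C S B : Set Q) (a : A) (S' C' Bs B' : Set Q),
    M.deltaF S a = ∅ ∧
    S' = M.deltaSCC S a ∩ P ∧
    C' = (M.deltaSet H a ∩ P) \ S' ∧
    Bs = M.deltaSCC B a ∧
    B' = (if Bs = ∅ then C' else Bs) ∧
    (x = ((H, C, S, B), a, (if Bs = ∅ then ({()} : Set Unit) else ∅),
          (M.deltaSet H a, C', S', B')) ∨
     (M.deltaF B a ∩ M.deltaSCC B a = ∅ ∧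
      x = ((H, C, S, B), a, ({()} : Set Unit),
           (M.deltaSet H a, C' \ (S' ∪ B'), S' ∪ B', C' \ (S' ∪ B')))))}
  acc := .inf ()

theorem Set.Infinite.exists_inter_fiber_infinite {α : Type u} {β : Type v} [Finite β] {s : Set α}
    (hs : s.Infinite) (f : α → β) : ∃ b, (s ∩ f ⁻¹' {b}).Infinite := by
  by_contra! hcon
  refine hs ((Set.finite_iUnion hcon).subset fun i hi => ?_)
  exact Set.mem_iUnion.2 ⟨f i, hi, rfl⟩

namespace BA

variable {Q : Type u} {A : Type v}

theorem IsSCC.mem_of_sameSCC {M : BA Q A} {C : Set Q} (hC : M.IsSCC C) {p q : Q}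
    (hp : p ∈ C) (h : M.SameSCC p q) : q ∈ C := by
  refine hC.2.2 (insert q C) (Set.subset_insert q C) ?_ (Set.mem_insert q C)
  rintro x (rfl | hx) y (rfl | hy)
  · exact .refl
  · exact h.2.trans (hC.2.1 p hp y hy)
  · exact (hC.2.1 x hx p hp).trans h.1
  · exact hC.2.1 x hx y hy

theorem IsSCC.sameSCC {M : BA Q A} {C : Set Q} (hC : M.IsSCC C) {p q : Q}
    (hp : p ∈ C) (hq : q ∈ C) : M.SameSCC p q :=
  ⟨hC.2.1 p hp q hq, hC.2.1 q hq p hp⟩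

theorem IsPartitionBlock.exists_isSCC {M : BA Q A} {P : Set Q} (hP : M.IsPartitionBlock P)
    {q : Q} (hq : q ∈ P) : ∃ C, M.IsSCC C ∧ C ⊆ P ∧ q ∈ C := by
  obtain ⟨-, Cs, hCs, rfl⟩ := hP
  obtain ⟨C, hC, hqC⟩ := hq
  exact ⟨C, (hCs C hC).1, Set.subset_sUnion_of_mem hC, hqC⟩

theorem IsPartitionBlock.deltaSCC_subset {M : BA Q A} {P : Set Q} (hP : M.IsPartitionBlock P)
    {B : Set Q} (hB : B ⊆ P) (a : A) : M.deltaSCC B a ⊆ P := by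
  rintro q ⟨p, hp, -, hpq⟩
  obtain ⟨C, hC, hCP, hpC⟩ := hP.exists_isSCC (hB hp)
  exact hCP (hC.mem_of_sameSCC hpC hpq)

theorem deltaSCC_mono (M : BA Q A) {B B' : Set Q} (h : B ⊆ B') (a : A) :
    M.deltaSCC B a ⊆ M.deltaSCC B' a :=
  fun _ ⟨p, hp, hq⟩ => ⟨p, h hp, hq⟩

theorem deltaSCC_subset_deltaSet (M : BA Q A) {B H : Set Q} (h : B ⊆ H) (a : A) :
    M.deltaSCC B a ⊆ M.deltaSet H a :=
  fun _ ⟨p, hp, hq, _⟩ => ⟨p, h hp, hq⟩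

/-- The states reached from `B` at time `n` after reading `j` letters of `w` without leaving
an SCC. -/
def sccIter (M : BA Q A) (w : ℕ → A) (n : ℕ) (B : Set Q) : ℕ → Set Q
  | 0 => B
  | j + 1 => M.deltaSCC (M.sccIter w n B j) (w (n + j))

theorem sccIter_add (M : BA Q A) (w : ℕ → A) (n : ℕ) (B : Set Q) (k j : ℕ) :
    M.sccIter w (n + k) (M.sccIter w n B k) j = M.sccIter w n B (k + j) := by
  induction j with
  | zero => rfl
  | succ j ih =>
    rw [← Nat.add_assoc k, sccIter, sccIter, ih, Nat.add_assoc]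

theorem mem_sccIter_iff (M : BA Q A) (w : ℕ → A) (n : ℕ) (B : Set Q) (j : ℕ) (q : Q) :
    q ∈ M.sccIter w n B j ↔ ∃ p ∈ B, q ∈ M.sccIter w n {p} j := by
  induction j generalizing q with
  | zero => simp [sccIter]
  | succ j ih =>
    constructor
    · rintro ⟨r, hr, h⟩
      obtain ⟨p, hp, hrp⟩ := (ih r).1 hr
      exact ⟨p, hp, r, hrp, h⟩
    · rintro ⟨p, hp, r, hr, h⟩
      exact ⟨r, (ih r).2 ⟨p, hp, hr⟩, h⟩

/-- No continuation from `S` at time `i` inside SCCs takes an accepting transition. -/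
def Safe (M : BA Q A) (w : ℕ → A) (i : ℕ) (S : Set Q) : Prop :=
  ∀ j, M.deltaF (M.sccIter w i S j) (w (i + j)) = ∅

theorem Safe.deltaF_eq_empty {M : BA Q A} {w : ℕ → A} {i : ℕ} {S : Set Q}
    (h : M.Safe w i S) : M.deltaF S (w i) = ∅ := h 0

theorem Safe.deltaSCC {M : BA Q A} {w : ℕ → A} {i : ℕ} {S : Set Q}
    (h : M.Safe w i S) : M.Safe w (i + 1) (M.deltaSCC S (w i)) := by
  intro j
  have h1 := M.sccIter_add w i S 1 j
  have h2 := h (1 + j)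
  rw [← h1, ← Nat.add_assoc] at h2
  exact h2

theorem Safe.mono {M : BA Q A} {w : ℕ → A} {i : ℕ} {S T : Set Q}
    (h : M.Safe w i T) (hST : S ⊆ T) : M.Safe w i S := by
  intro j
  refine Set.subset_eq_empty ?_ (h j)
  rintro q ⟨p, hp, hpq⟩
  obtain ⟨s, hs, hsp⟩ := (M.mem_sccIter_iff w i S j p).1 hp
  exact ⟨p, (M.mem_sccIter_iff w i T j p).2 ⟨s, hST hs, hsp⟩, hpq⟩

theorem Safe.union {M : BA Q A} {w : ℕ → A} {i : ℕ} {S T : Set Q}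
    (hS : M.Safe w i S) (hT : M.Safe w i T) : M.Safe w i (S ∪ T) := by
  intro j
  rw [Set.eq_empty_iff_forall_notMem]
  rintro q ⟨p, hp, hpq⟩
  obtain ⟨s, hs, hsp⟩ := (M.mem_sccIter_iff w i _ j p).1 hp
  rcases hs with hs | hs
  · exact (hS j).subset ⟨p, (M.mem_sccIter_iff w i S j p).2 ⟨s, hs, hsp⟩, hpq⟩
  · exact (hT j).subset ⟨p, (M.mem_sccIter_iff w i T j p).2 ⟨s, hs, hsp⟩, hpq⟩

theorem safe_empty (M : BA Q A) (w : ℕ → A) (i : ℕ) : M.Safe w i ∅ := by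
  intro j
  rw [Set.eq_empty_iff_forall_notMem]
  rintro q ⟨p, hp, -⟩
  obtain ⟨s, hs, -⟩ := (M.mem_sccIter_iff w i ∅ j p).1 hp
  exact hs

/-- `q` is reached at time `n` by a finite run on the prefix of `w` of length `n`. -/
def ReachedAt (M : BA Q A) (w : ℕ → A) (n : ℕ) (q : Q) : Prop :=
  ∃ r : ℕ → Q, r 0 ∈ M.init ∧ (∀ k < n, (r k, w k, r (k + 1)) ∈ M.delta) ∧ r n = q

theorem ReachedAt.isRun_append {M : BA Q A} {w : ℕ → A} {n : ℕ} {t : ℕ → Q}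
    (h : M.ReachedAt w n (t 0)) (ht : ∀ j, (t j, w (n + j), t (j + 1)) ∈ M.delta) :
    ∃ ρ, M.IsRun w ρ ∧ ∀ j, ρ (n + j) = t j := by
  obtain ⟨r, h0, hr, hn⟩ := h
  refine ⟨fun k => if k ≤ n then r k else t (k - n), ⟨by simpa using h0, fun i => ?_⟩, fun j => ?_⟩
  · rcases lt_trichotomy i n with hi | rfl | hi
    · simpa [hi.le, Nat.succ_le_of_lt hi] using hr i hi
    · simpa [hn] using ht 0
    · have := ht (i - n)
      rw [Nat.add_sub_cancel' hi.le, ← Nat.sub_add_comm hi.le] at this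
      simpa [hi.not_ge, (hi.trans (Nat.lt_succ_self i)).not_ge] using this
  · rcases j with _ | j
    · simpa using hn
    · simp

theorem ReachedAt.step {M : BA Q A} {w : ℕ → A} {n : ℕ} {p q : Q}
    (h : M.ReachedAt w n p) (hpq : (p, w n, q) ∈ M.delta) : M.ReachedAt w (n + 1) q := by
  obtain ⟨r, h0, hr, hn⟩ := h
  refine ⟨fun k => if k ≤ n then r k else q, by simpa using h0, fun k hk => ?_, by simp⟩
  rcases (Nat.lt_succ_iff.1 hk).lt_or_eq with hk | rfl
  · simpa [hk.le, Nat.succ_le_of_lt hk] using hr k hk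
  · simpa [hn] using hpq

theorem sccIter_subset_of_block {M : BA Q A} {P : Set Q} (hP : M.IsPartitionBlock P)
    (w : ℕ → A) (n : ℕ) {B : Set Q} (hB : B ⊆ P) (j : ℕ) : M.sccIter w n B j ⊆ P := by
  induction j with
  | zero => exact hB
  | succ j ih => exact hP.deltaSCC_subset ih _

theorem subsingleton_sccIter {M : BA Q A} {P : Set Q} (hP : M.IsPartitionBlock P)
    (hdet : ∀ C, M.IsSCC C → C ⊆ P → M.DetSCC C) (w : ℕ → A) (n : ℕ) {p : Q} (hp : p ∈ P)
    (j : ℕ) : (M.sccIter w n {p} j).Subsingleton := by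
  induction j with
  | zero => exact Set.subsingleton_singleton
  | succ j ih =>
    rintro x ⟨r, hr, hrx, hx⟩ y ⟨r', hr', hry, hy⟩
    obtain rfl := ih hr hr'
    obtain ⟨C, hC, hCP, hrC⟩ := hP.exists_isSCC
      (sccIter_subset_of_block hP w n (Set.singleton_subset_iff.2 hp) j hr)
    exact hdet C hC hCP r hrC _ ⟨⟨r, rfl, hrx⟩, hC.mem_of_sameSCC hrC hx⟩
      ⟨⟨r, rfl, hry⟩, hC.mem_of_sameSCC hrC hy⟩

theorem sccIter_nonempty_of_le {M : BA Q A} {w : ℕ → A} {n : ℕ} {B : Set Q} {j k : ℕ}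
    (hjk : j ≤ k) (h : (M.sccIter w n B k).Nonempty) : (M.sccIter w n B j).Nonempty := by
  induction k, hjk using Nat.le_induction with
  | base => exact h
  | succ k _ ih =>
    obtain ⟨-, p, hp, -⟩ := h
    exact ih ⟨p, hp⟩

/-- Inside a deterministic block, a word outside the language eventually forces the SCC-internal
run from a single reachable state to avoid accepting transitions. -/
theorem exists_deltaF_sccIter_singleton_eq_empty {M : BA Q A} {P : Set Q}
    (hP : M.IsPartitionBlock P) (hdet : ∀ C, M.IsSCC C → C ⊆ P → M.DetSCC C)
    (hF : ∀ p a q, (p, a, q) ∈ M.F → M.SameSCC p q) {w : ℕ → A} (hw : w ∉ M.lang) {n : ℕ} {p : Q}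
    (hp : p ∈ P) (hr : M.ReachedAt w n p) :
    ∃ K, ∀ j ≥ K, M.deltaF (M.sccIter w n {p} j) (w (n + j)) = ∅ := by
  by_contra! hcon
  have hne : ∀ j, (M.sccIter w n {p} j).Nonempty := fun j => by
    obtain ⟨k, hk, -, q, hq, -⟩ := hcon j
    exact sccIter_nonempty_of_le hk ⟨q, hq⟩
  have hsub := subsingleton_sccIter hP hdet w n hp
  choose t ht using hne
  have ht0 : t 0 = p := ht 0
  have hstep : ∀ j, (t j, w (n + j), t (j + 1)) ∈ M.delta := fun j => by
    obtain ⟨q, hq, h, -⟩ := ht (j + 1)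
    rwa [hsub j (ht j) hq]
  obtain ⟨ρ, hρ, hρt⟩ := ReachedAt.isRun_append (ht0 ▸ hr) hstep
  refine hw ⟨ρ, hρ, Set.infinite_of_not_bddAbove ?_⟩
  rintro ⟨b, hb⟩
  obtain ⟨j, hj, x, q, hq, hqx⟩ := hcon (b + 1)
  have hx : x = t (j + 1) := hsub (j + 1) ⟨q, hq, M.F_sub hqx, hF _ _ _ hqx⟩ (ht (j + 1))
  have : n + j ≤ b := hb (by
    rw [Set.mem_ofPred_eq, Nat.add_assoc, hρt, hρt, hsub j (ht j) hq, ← hx]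
    exact hqx)
  omega

theorem exists_safe_sccIter [Finite Q] {M : BA Q A} {P : Set Q}
    (hP : M.IsPartitionBlock P) (hdet : ∀ C, M.IsSCC C → C ⊆ P → M.DetSCC C)
    (hF : ∀ p a q, (p, a, q) ∈ M.F → M.SameSCC p q) {w : ℕ → A} (hw : w ∉ M.lang) {n : ℕ}
    {B : Set Q} (hB : B ⊆ P) (hr : ∀ p ∈ B, M.ReachedAt w n p) :
    ∃ K, M.Safe w (n + K) (M.sccIter w n B K) := by
  choose! K hK using fun p (hp : p ∈ B) =>
    exists_deltaF_sccIter_singleton_eq_empty hP hdet hF hw (hB hp) (hr p hp)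
  obtain ⟨N, hN⟩ := (Set.finite_range K).bddAbove
  refine ⟨N, fun j => ?_⟩
  rw [sccIter_add, Nat.add_assoc, Set.eq_empty_iff_forall_notMem]
  rintro x ⟨q, hq, hqx⟩
  obtain ⟨p, hp, hpq⟩ := (M.mem_sccIter_iff w n B _ q).1 hq
  exact (hK p hp (N + j) ((hN ⟨p, rfl⟩).trans (Nat.le_add_right N j))).subset ⟨q, hpq, hqx⟩

theorem IsRun.reach {M : BA Q A} {w : ℕ → A} {ρ : ℕ → Q} (h : M.IsRun w ρ) {i j : ℕ}
    (hij : i ≤ j) : M.Reach (ρ i) (ρ j) := by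
  induction j, hij using Nat.le_induction with
  | base => exact .refl
  | succ j _ ih => exact ih.tail ⟨w j, h.2 j⟩

/-- An accepting run is eventually trapped in an SCC containing accepting transitions. -/
theorem AccRun.exists_isSCC [Finite Q] {M : BA Q A} {P : Set Q}
    (hF : ∀ p a q, (p, a, q) ∈ M.F → ∃ C, M.IsSCC C ∧ C ⊆ P ∧ p ∈ C ∧ q ∈ C)
    {w : ℕ → A} {ρ : ℕ → Q} (h : M.AccRun w ρ) :
    ∃ C, M.IsSCC C ∧ C ⊆ P ∧ ∃ n, ∀ i ≥ n, ρ i ∈ C := by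
  obtain ⟨s, hs⟩ := h.2.exists_inter_fiber_infinite ρ
  obtain ⟨n, hn, hns⟩ := hs.nonempty
  obtain ⟨C, hC, hCP, hsC, -⟩ := hF _ _ _ hn
  refine ⟨C, hC, hCP, n, fun i hi => ?_⟩
  obtain ⟨j, ⟨-, hj⟩, hij⟩ := hs.exists_gt i
  have hjn : ρ j = ρ n := hj.trans hns.symm
  exact hC.mem_of_sameSCC hsC ⟨h.1.reach hi, hjn ▸ h.1.reach hij.le⟩

end BA

theorem TELA.mem_infCols_iff {Q : Type u} {A : Type v} {γ : Type w} [Finite Q] [Finite A]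
    [Finite γ] (w : ℕ → A) (ρ : ℕ → Q) (κ : ℕ → Set γ) (c : γ) :
    c ∈ TELA.infCols w ρ κ ↔ {i | c ∈ κ i}.Infinite := by
  constructor
  · rintro ⟨t, ht, hc⟩
    refine ht.mono ?_
    rintro i rfl
    exact hc
  · intro h
    obtain ⟨t, ht⟩ := h.exists_inter_fiber_infinite fun i => (ρ i, w i, κ i, ρ (i + 1))
    refine ⟨t, ht.mono fun i hi => hi.2, ?_⟩
    obtain ⟨i, hi, rfl⟩ := ht.nonempty
    exact hi

section

variable {Q A : Type}

/-- Semantic invariant maintained by the accepting run of `dacTELA` on a word outside the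
language: the tracked states are reachable and the safe component is `BA.Safe`. -/
structure DacInv (M : BA Q A) (P : Set Q) (w : ℕ → A) (i : ℕ)
    (X : Set Q × Set Q × Set Q × Set Q) : Prop where
  reached : ∀ q ∈ X.1, M.ReachedAt w i q
  safe : M.Safe w i X.2.2.1
  subset_block : X.2.2.2 ⊆ P
  subset_reached : X.2.2.2 ⊆ X.1

theorem DacInv.exists_next {M : BA Q A} {P : Set Q} (hP : M.IsPartitionBlock P) {w : ℕ → A}
    {i : ℕ} {X : Set Q × Set Q × Set Q × Set Q} (h : DacInv M P w i X) :
    ∃ Y κ, (X, w i, κ, Y) ∈ (dacTELA M P).trans ∧ DacInv M P w (i + 1) Y ∧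
      (() ∉ κ → Y.2.2.2 = M.deltaSCC X.2.2.2 (w i) ∧ ¬ M.Safe w i X.2.2.2) := by
  obtain ⟨H, C, S, B⟩ := X
  obtain ⟨hH, hS, hBP, hBH⟩ := h
  dsimp only at hH hS hBP hBH
  have hH' : ∀ q ∈ M.deltaSet H (w i), M.ReachedAt w (i + 1) q :=
    fun q ⟨p, hp, hpq⟩ => (hH p hp).step hpq
  have hS' : M.Safe w (i + 1) (M.deltaSCC S (w i) ∩ P) := hS.deltaSCC.mono Set.inter_subset_left
  by_cases hB : M.deltaSCC B (w i) = ∅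
  · refine ⟨_, _, ⟨H, C, S, B, w i, _, _, _, _, hS.deltaF_eq_empty, rfl, rfl, rfl, rfl,
      Or.inl rfl⟩, ⟨hH', hS', ?_, ?_⟩, ?_⟩
    · simp only [hB, if_true]
      exact fun q hq => hq.1.2
    · simp only [hB, if_true]
      exact fun q hq => hq.1.1
    · simp [hB]
  · by_cases hsafe : M.Safe w i B
    · refine ⟨_, _, ⟨H, C, S, B, w i, _, _, _, _, hS.deltaF_eq_empty, rfl, rfl, rfl, rfl,
        Or.inr ⟨by rw [hsafe.deltaF_eq_empty, Set.empty_inter], rfl⟩⟩,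
        ⟨hH', ?_, fun q hq => hq.1.1.2, fun q hq => hq.1.1.1⟩, ?_⟩
      · simp only [hB, if_false]
        exact hS'.union hsafe.deltaSCC
      · simp
    · refine ⟨_, _, ⟨H, C, S, B, w i, _, _, _, _, hS.deltaF_eq_empty, rfl, rfl, rfl, rfl,
        Or.inl rfl⟩, ⟨hH', hS', ?_, ?_⟩, ?_⟩
      · simp only [hB, if_false]
        exact hP.deltaSCC_subset hBP _
      · simp only [hB, if_false]
        exact M.deltaSCC_subset_deltaSet hBH _
      · simp [hB, hsafe]

theorem dacInv_init (M : BA Q A) (P : Set Q) (w : ℕ → A) :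
    DacInv M P w 0 (M.init, M.init ∩ P, ∅, M.init ∩ P) where
  reached q hq := ⟨fun _ => q, hq, by simp, rfl⟩
  safe := M.safe_empty w 0
  subset_block := Set.inter_subset_right
  subset_reached := Set.inter_subset_left

theorem mem_dacTELA_lang_of_notMem [Finite Q] [Finite A] {M : BA Q A} {P : Set Q}
    (hP : M.IsPartitionBlock P) (hdet : ∀ C, M.IsSCC C → C ⊆ P → M.DetSCC C)
    (hF : ∀ p a q, (p, a, q) ∈ M.F → M.SameSCC p q) {w : ℕ → A} (hw : w ∉ M.lang) :
    w ∈ (dacTELA M P).lang := by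
  choose next col htrans hinv hprog using
    fun i X (h : DacInv M P w i X) => h.exists_next hP
  let s : (i : ℕ) → {X // DacInv M P w i X} := fun i =>
    Nat.rec ⟨_, dacInv_init M P w⟩ (fun i X => ⟨next i X.1 X.2, hinv i X.1 X.2⟩) i
  refine ⟨fun i => (s i).1, fun i => col i (s i).1 (s i).2,
    ⟨rfl, fun i => htrans i (s i).1 (s i).2⟩, ?_⟩
  refine (TELA.mem_infCols_iff _ _ _ _).2 (Set.infinite_of_not_bddAbove ?_)
  rintro ⟨b, hb⟩
  have hstep : ∀ i, b + 1 ≤ i → (s (i + 1)).1.2.2.2 = M.deltaSCC (s i).1.2.2.2 (w i) ∧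
      ¬ M.Safe w i (s i).1.2.2.2 := fun i hi =>
    hprog i (s i).1 (s i).2 fun h => by
      have : i ≤ b := hb h
      omega
  have hiter : ∀ j, (s (b + 1 + j)).1.2.2.2 = M.sccIter w (b + 1) (s (b + 1)).1.2.2.2 j := by
    intro j
    induction j with
    | zero => rfl
    | succ j ih =>
      rw [← Nat.add_assoc, (hstep (b + 1 + j) (Nat.le_add_right _ _)).1, ih]
      rfl
  have hs := (s (b + 1)).2
  obtain ⟨K, hK⟩ := BA.exists_safe_sccIter hP hdet hF hw hs.subset_block
    fun p hp => hs.reached p (hs.subset_reached hp)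
  exact (hstep (b + 1 + K) (Nat.le_add_right _ _)).2 (hiter K ▸ hK)

theorem dacTELA_reached_mem {M : BA Q A} {P : Set Q} {w : ℕ → A} {ρ : ℕ → Q}
    (hρ : M.IsRun w ρ) {σ : ℕ → Set Q × Set Q × Set Q × Set Q} {κ : ℕ → Set Unit}
    (hσ : (dacTELA M P).IsRun w σ κ) (i : ℕ) : ρ i ∈ (σ i).1 := by
  induction i with
  | zero =>
    have h0 : σ 0 = _ := hσ.1
    rw [h0]
    exact hρ.1
  | succ i ih =>
    obtain ⟨H, C, S, B, a, S', C', Bs, B', -, -, -, -, -, h | ⟨-, h⟩⟩ := hσ.2 i <;>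
    · simp only [Prod.mk.injEq] at h
      obtain ⟨h1, rfl, -, h2⟩ := h
      rw [h1] at ih
      rw [h2]
      exact ⟨ρ i, ih, hρ.2 i⟩

theorem notMem_lang_of_mem_dacTELA_lang [Finite Q] [Finite A] {M : BA Q A} {P : Set Q}
    (hF : ∀ p a q, (p, a, q) ∈ M.F → ∃ C, M.IsSCC C ∧ C ⊆ P ∧ p ∈ C ∧ q ∈ C) {w : ℕ → A}
    (hw : w ∈ (dacTELA M P).lang) : w ∉ M.lang := by
  rintro ⟨ρ, hρ⟩
  obtain ⟨σ, κ, hσ, hacc⟩ := hw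
  have hinf : {i | () ∈ κ i}.Infinite := (TELA.mem_infCols_iff _ _ _ _).1 hacc
  obtain ⟨C, hC, hCP, n, hn⟩ := hρ.exists_isSCC hF
  have hreach := dacTELA_reached_mem hρ.1 hσ
  have hsame : ∀ i ≥ n, M.SameSCC (ρ i) (ρ (i + 1)) := fun i hi =>
    hC.sameSCC (hn i hi) (hn _ (hi.trans (Nat.le_succ i)))
  have hnF : ∀ i, ρ i ∈ (σ i).2.2.1 → (ρ i, w i, ρ (i + 1)) ∉ M.F := by
    intro i hi hFi
    obtain ⟨H, C, S, B, a, S', C', Bs, B', hS, -, -, -, -, h | ⟨-, h⟩⟩ := hσ.2 i <;>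
    · simp only [Prod.mk.injEq] at h
      obtain ⟨h1, rfl, -⟩ := h
      rw [h1] at hi
      exact hS.subset ⟨ρ i, hi, hFi⟩
  have hSstep : ∀ i ≥ n, ρ i ∈ (σ i).2.2.1 → ρ (i + 1) ∈ (σ (i + 1)).2.2.1 := by
    intro i hi hS
    have hP := hCP (hn (i + 1) (hi.trans (Nat.le_succ i)))
    obtain ⟨H, C, S, B, a, S', C', Bs, B', -, rfl, -, -, -, h | ⟨-, h⟩⟩ := hσ.2 i <;>
    · simp only [Prod.mk.injEq] at h
      obtain ⟨h1, rfl, -, h2⟩ := h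
      rw [h1] at hS
      rw [h2]
      have := And.intro (⟨ρ i, hS, hρ.1.2 i, hsame i hi⟩ :
        ρ (i + 1) ∈ M.deltaSCC S (w i)) hP
      first | exact this | exact Or.inl this
  have hS : ∀ i ≥ n, ρ i ∉ (σ i).2.2.1 := by
    intro i hi hS
    have hall : ∀ j ≥ i, ρ j ∈ (σ j).2.2.1 := fun j hj => by
      induction j, hj using Nat.le_induction with
      | base => exact hS
      | succ j hj ih => exact hSstep j (hi.trans hj) ih
    obtain ⟨j, hj, hij⟩ := hρ.2.exists_gt i
    exact hnF j (hall j hij.le) hj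
  have hcol : ∀ i ≥ n, () ∈ κ i → ρ (i + 1) ∈ (σ (i + 1)).2.2.2 ∧ ρ i ∉ (σ i).2.2.2 := by
    intro i hi hκ
    have hP := hCP (hn (i + 1) (hi.trans (Nat.le_succ i)))
    have hH := hreach i
    have hS' := hS (i + 1) (hi.trans (Nat.le_succ i))
    obtain ⟨H, C, S, B, a, S', C', Bs, B', -, hS'_eq, rfl, rfl, rfl, h | ⟨-, h⟩⟩ := hσ.2 i
    · simp only [Prod.mk.injEq] at h
      obtain ⟨h1, rfl, h3, h2⟩ := h
      rw [h1] at hH ⊢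
      rw [h2] at hS' ⊢
      by_cases hB : M.deltaSCC B (w i) = ∅
      · simp only [hB, if_true]
        exact ⟨⟨⟨⟨ρ i, hH, hρ.1.2 i⟩, hP⟩, hS'⟩,
          fun hmem => hB.subset ⟨ρ i, hmem, hρ.1.2 i, hsame i hi⟩⟩
      · simp [h3, hB] at hκ
    · simp only [Prod.mk.injEq] at h
      obtain ⟨h1, rfl, -, h2⟩ := h
      rw [h1] at hH ⊢
      rw [h2] at hS' ⊢
      refine ⟨⟨⟨⟨⟨ρ i, hH, hρ.1.2 i⟩, hP⟩, fun h => hS' (Or.inl h)⟩, hS'⟩, fun hmem => hS' ?_⟩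
      have hmem' : ρ (i + 1) ∈ M.deltaSCC B (w i) := ⟨ρ i, hmem, hρ.1.2 i, hsame i hi⟩
      refine Or.inr ?_
      rwa [if_neg (Set.nonempty_iff_ne_empty.1 ⟨_, hmem'⟩)]
  have hBstep : ∀ i ≥ n, ρ i ∈ (σ i).2.2.2 → ρ (i + 1) ∈ (σ (i + 1)).2.2.2 := by
    intro i hi hB
    by_cases hκ : () ∈ κ i
    · exact (hcol i hi hκ).1
    obtain ⟨H, C, S, B, a, S', C', Bs, B', -, -, -, rfl, rfl, h | ⟨-, h⟩⟩ := hσ.2 i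
    · simp only [Prod.mk.injEq] at h
      obtain ⟨h1, rfl, -, h2⟩ := h
      rw [h1] at hB
      rw [h2]
      have hmem : ρ (i + 1) ∈ M.deltaSCC B (w i) := ⟨ρ i, hB, hρ.1.2 i, hsame i hi⟩
      simpa only [if_neg (Set.nonempty_iff_ne_empty.1 ⟨_, hmem⟩)] using hmem
    · simp only [Prod.mk.injEq] at h
      simp [h.2.2.1] at hκ
  obtain ⟨i, hi, hni⟩ := hinf.exists_gt n
  obtain ⟨k, hk, hik⟩ := hinf.exists_gt i
  have hB : ∀ j ≥ i + 1, ρ j ∈ (σ j).2.2.2 := fun j hj => by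
    induction j, hj using Nat.le_induction with
    | base => exact (hcol i hni.le hi).1
    | succ j hj ih => exact hBstep j (by omega) ih
  exact (hcol k (hni.trans hik).le hk).2 (hB k hik)

end

theorem statement4 {Q A : Type} [Fintype Q] [Fintype A] [Nonempty A]
    (M : BA Q A) (hcompl : M.Complete) (P : Set Q)
    (hblock : M.IsPartitionBlock P)
    (hdet : ∀ C, M.IsSCC C → C ⊆ P → M.IsAccSCC C ∧ M.DetSCC C)
    (hF : ∀ p a q, (p, a, q) ∈ M.F → ∃ C, M.IsSCC C ∧ C ⊆ P ∧ p ∈ C ∧ q ∈ C) :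
    (dacTELA M P).lang = (M.lang)ᶜ := by
  ext w
  constructor
  · exact notMem_lang_of_mem_dacTELA_lang hF
  · refine mem_dacTELA_lang_of_notMem hblock (fun C hC hCP => (hdet C hC hCP).2) ?_
    intro p a q hpq
    obtain ⟨C, hC, -, hp, hq⟩ := hF p a q hpq
    exact hC.sameSCC hp hq
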